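/- Let K be a nonempty half-plane hull with hydrodynamic conformal map f : ℍ → ℍ \ K. If z ∈ ℍ satisfies dist(z,K) ≥ 7·diam(K), then |f'(z) − 1| ≤ 1/2. In particular f is bi-Lipschitz with uniform constants on the region {z ∈ ℍ : dist(z,K) ≥ 7·diam(K)}. -/

import Mathlib

open Set Metric Filter Bornology Complex Function

noncomputable section

/-- The upper half-plane as a subset of `ℂ`. -/
def UHP : Set ℂ := {z : ℂ | 0 < z.im}

/-- `K` is a half-plane hull: a bounded subset of the upper half-plane whose
complement in the upper half-plane is a simply connected domain. -/
def IsHull (K : Set ℂ) : Prop :=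
  IsBounded K ∧ K ⊆ UHP ∧ IsOpen (UHP \ K) ∧ IsConnected (UHP \ K) ∧
    SimplyConnectedSpace ↥(UHP \ K)

/-- `f` is the hydrodynamic conformal map of the hull `K`: a conformal bijection
from the upper half-plane onto `UHP \ K` with `f z - z → 0` as `|z| → ∞` in `UHP`. -/
def IsHydroMap (K : Set ℂ) (f : ℂ → ℂ) : Prop :=
  DifferentiableOn ℂ f UHP ∧ InjOn f UHP ∧ f '' UHP = UHP \ K ∧
    Tendsto (fun z => f z - z) (cobounded ℂ ⊓ 𝓟 UHP) (nhds (0 : ℂ))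

/-- `f` is the hydrodynamic map of `K` and `g` is its inverse. -/
def IsHydroPair (K : Set ℂ) (f g : ℂ → ℂ) : Prop :=
  IsHydroMap K f ∧ InvOn g f UHP (UHP \ K)

/-- `K` has half-plane capacity `a`, computed via its hydrodynamic map `f`:
`z * (z - f z) → a` as `|z| → ∞` in `UHP`. -/
def HasHcap (K : Set ℂ) (f : ℂ → ℂ) (a : ℝ) : Prop :=
  Tendsto (fun z => z * (z - f z)) (cobounded ℂ ⊓ 𝓟 UHP) (nhds (a : ℂ))

/-- The `(β, C₀)`-Hölder condition for a map defined on the upper half-plane. -/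
def IsHolder (f : ℂ → ℂ) (β C₀ : ℝ) : Prop :=
  ∀ z ∈ UHP, ∀ z' ∈ UHP, dist (f z) (f z') ≤ C₀ * max (dist z z' ^ β) (dist z z')

/-- The Poincaré hyperbolic distance on the upper half-plane. -/
def rhoH (z w : ℂ) : ℝ :=
  2 * Real.arsinh (dist z w / (2 * Real.sqrt (z.im * w.im)))

/-- The hyperbolic distance on a simply connected domain `Ω`, transported through a
conformal bijection `φ : UHP → Ω` (independent of the choice of `φ`). -/
def rhoVia (φ : ℂ → ℂ) (z w : ℂ) : ℝ :=
  rhoH (invFunOn φ UHP z) (invFunOn φ UHP w)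

/-- `log⁺ x = max (log x) 0`. -/
def posLog (x : ℝ) : ℝ := max (Real.log x) 0

/-- Internal distance between `A` and `B` inside `Ω`: the infimum of diameters of
connected subsets of `Ω` meeting both `A` and `B`. -/
def distIn (Ω A B : Set ℂ) : ℝ :=
  sInf {d : ℝ | ∃ E : Set ℂ, E ⊆ Ω ∧ IsConnected E ∧ (E ∩ A).Nonempty ∧
    (E ∩ B).Nonempty ∧ d = Metric.diam E}

/-- Internal diameter of `A` inside `Ω`. -/
def diamIn (Ω A : Set ℂ) : ℝ :=
  sSup {d : ℝ | ∃ a ∈ A, ∃ b ∈ A, d = distIn Ω {a} {b}}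

/-- An `L`-John curve in `Ω` with tip `z`, parametrized on `[0,1)` (the base-point,
which is not required to lie in `Ω`, corresponds to the missing endpoint). -/
def IsJohnCurve (Ω : Set ℂ) (L : ℝ) (α : ℝ → ℂ) (z : ℂ) : Prop :=
  ContinuousOn α (Ico 0 1) ∧ InjOn α (Ico 0 1) ∧ α 0 = z ∧
    MapsTo α (Ico 0 1) Ω ∧
    ∀ t ∈ Ico (0:ℝ) 1, Metric.diam (α '' Icc 0 t) ≤ L * infDist (α t) (frontier Ω)

/-- An `L`-John curve in `Ω` with tip `z` and base-point `∞`, parametrized on `[0,∞)`. -/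
def IsJohnCurveInfty (Ω : Set ℂ) (L : ℝ) (α : ℝ → ℂ) (z : ℂ) : Prop :=
  ContinuousOn α (Ici 0) ∧ InjOn α (Ici 0) ∧ α 0 = z ∧
    MapsTo α (Ici 0) Ω ∧ Tendsto α atTop (cobounded ℂ) ∧
    ∀ t ∈ Ici (0:ℝ), Metric.diam (α '' Icc 0 t) ≤ L * infDist (α t) (frontier Ω)


open scoped Topology

lemma uhp_isOpen : IsOpen UHP := isOpen_lt continuous_const Complex.continuous_im

lemma hull_im_le {K : Set ℂ} (hK : IsHull K) {p : ℂ} (hp : p ∈ K) : p.im ≤ Metric.diam K := by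
  obtain ⟨hb, hsub, ho, hc, hs⟩ := hK
  by_contra! hlt
  obtain ⟨r, hr1, hr2⟩ := exists_between hlt
  have hd : 0 ≤ Metric.diam K := Metric.diam_nonneg
  have hr0 : 0 < r := lt_of_le_of_lt hd hr1
  have hsc : IsSimplyConnected (UHP \ K) := hs
  obtain ⟨L, hL, hexp⟩ := Complex.exists_continuousOn_eqOn_exp_comp hsc ho
    (g := fun w => w - p) (by fun_prop) (by
      rintro ⟨w, hw, h0⟩
      have : w = p := sub_eq_zero.1 h0
      exact hw.2 (this ▸ hp))
  have hsph : ∀ w ∈ sphere p r, w ∈ UHP \ K := by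
    intro w hw
    rw [mem_sphere] at hw
    refine ⟨?_, fun hwK => ?_⟩
    · have h1 : |(w - p).im| ≤ ‖w - p‖ := Complex.abs_im_le_norm _
      rw [← dist_eq_norm, hw] at h1
      have := (abs_le.1 h1).1
      simp only [Complex.sub_im] at this
      change 0 < w.im
      linarith
    · have := Metric.dist_le_diam_of_mem hb hwK hp
      linarith
  have h0 : (∮ z in C(p, r), (z - p)⁻¹) = 0 := by
    apply circleIntegral.integral_eq_zero_of_hasDerivWithinAt hr0.le (f := L)
    intro w hw
    have hwO := hsph w hw
    have hnb : UHP \ K ∈ 𝓝 w := ho.mem_nhds hwO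
    have e1 : Complex.exp (L w) = w - p := hexp hwO
    have hder : HasDerivAt (fun z => Complex.exp z + p) (w - p) (L w) := by
      rw [← e1]; exact (Complex.hasDerivAt_exp _).add_const p
    have hne : w - p ≠ 0 := by rw [← e1]; exact Complex.exp_ne_zero _
    refine (HasDerivAt.of_local_left_inverse (hL.continuousAt hnb) hder hne ?_).hasDerivWithinAt
    filter_upwards [hnb] with y hy
    have : Complex.exp (L y) = y - p := hexp hy
    rw [this]; ring
  rw [circleIntegral.integral_sub_center_inv p hr0.ne'] at h0
  exact Complex.two_pi_I_ne_zero h0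

lemma uhp_preconnected : IsPreconnected UHP :=
  (convex_halfSpace_im_gt 0).isPreconnected

lemma inv_exists {K : Set ℂ} {f : ℂ → ℂ} (ho : IsOpen (UHP \ K)) (hf : IsHydroMap K f) :
    ∃ g : ℂ → ℂ, DifferentiableOn ℂ g (UHP \ K) ∧ (∀ w ∈ UHP \ K, g w ∈ UHP ∧ f (g w) = w) ∧
      ∀ z ∈ UHP, g (f z) = z := by
  obtain ⟨hd, hi, him, -⟩ := hf
  have hinv : ∀ w ∈ UHP \ K, invFunOn f UHP w ∈ UHP ∧ f (invFunOn f UHP w) = w := by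
    intro w hw
    rw [← him] at hw
    exact ⟨invFunOn_mem hw, invFunOn_eq hw⟩
  have hinv2 : ∀ z ∈ UHP, invFunOn f UHP (f z) = z := fun z hz => hi.leftInvOn_invFunOn hz
  refine ⟨invFunOn f UHP, ?_, hinv, hinv2⟩
  set g := invFunOn f UHP with hg
  have han : AnalyticOnNhd ℂ f UHP := hd.analyticOnNhd uhp_isOpen
  have hopen : ∀ s ⊆ UHP, IsOpen s → IsOpen (f '' s) := by
    rcases han.is_constant_or_isOpen uhp_preconnected with ⟨w, hw⟩ | h
    · exfalso
      have h1 : (Complex.I) ∈ UHP := by simp [UHP]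
      have h2 : (2 * Complex.I) ∈ UHP := by simp [UHP]
      have := hi h1 h2 ((hw _ h1).trans (hw _ h2).symm)
      have := congrArg Complex.im this
      norm_num at this
    · exact h
  have hcont : ∀ w ∈ UHP \ K, ContinuousAt g w := by
    intro w hw
    rw [ContinuousAt, tendsto_def]
    intro s hs
    obtain ⟨t, hts, hto, hwt⟩ := _root_.mem_nhds_iff.1 (inter_mem hs (uhp_isOpen.mem_nhds (hinv w hw).1))
    have h1 : f '' t ∈ 𝓝 w := (hopen t (fun x hx => (hts hx).2) hto).mem_nhds
      ⟨g w, hwt, (hinv w hw).2⟩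
    filter_upwards [h1]
    rintro _ ⟨z, hz, rfl⟩
    have := hts hz
    show g (f z) ∈ s
    rw [hinv2 z this.2]; exact this.1
  have hdiff : ∀ w ∈ UHP \ K, deriv f (g w) ≠ 0 → DifferentiableAt ℂ g w := by
    intro w hw hne
    refine (HasDerivAt.of_local_left_inverse (hcont w hw)
      (hd.differentiableAt (uhp_isOpen.mem_nhds (hinv w hw).1)).hasDerivAt hne ?_).differentiableAt
    filter_upwards [ho.mem_nhds hw] with y hy using (hinv y hy).2
  intro w hw
  apply DifferentiableAt.differentiableWithinAt
  apply AnalyticAt.differentiableAt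
  apply Complex.analyticAt_of_differentiable_on_punctured_nhds_of_continuousAt _ (hcont w hw)
  have hz := (hinv w hw).1
  have hda : AnalyticAt ℂ (deriv f) (g w) := (han _ hz).deriv
  rcases hda.eventually_eq_zero_or_eventually_ne_zero with h | h
  · exfalso
    obtain ⟨e, he, heb⟩ := Metric.mem_nhds_iff.1 (inter_mem h (uhp_isOpen.mem_nhds hz))
    have hc : ∀ x ∈ ball (g w) e, f x = f (g w) := by
      intro x hx
      refine isOpen_ball.is_const_of_deriv_eq_zero (convex_ball _ _).isPreconnected
        (hd.mono fun y hy => (heb hy).2) (fun y hy => (heb hy).1) hx (mem_ball_self he)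
    have hx : g w + (e/2 : ℝ) ∈ ball (g w) e := by
      simp [abs_of_pos he]; linarith
    have := hi (heb hx).2 hz (hc _ hx)
    have h3 : ((e/2 : ℝ) : ℂ) = 0 := by simpa using this
    have h4 : e/2 = 0 := by exact_mod_cast h3
    linarith
  · rw [eventually_nhdsWithin_iff] at h ⊢
    filter_upwards [(hcont w hw).eventually h, ho.mem_nhds hw] with y hy hyO hyne
    refine hdiff y hyO (hy ?_)
    intro heq
    apply hyne
    have := congrArg f (show g y = g w from heq)
    rwa [(hinv y hyO).2, (hinv w hw).2] at this

lemma schwarz_im {F : ℂ → ℂ} {c : ℂ} {r : ℝ} (hr : 0 < r) (hF : DifferentiableOn ℂ F (ball c r))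
    (him : ∀ z ∈ ball c r, 0 ≤ (F z).im) : ‖deriv F c‖ ≤ 2 * (F c).im / r := by
  have hFc : HasDerivAt F (deriv F c) c :=
    (hF.differentiableAt (isOpen_ball.mem_nhds (mem_ball_self hr))).hasDerivAt
  have key : ∀ η > 0, ‖deriv F c‖ ≤ 2 * ((F c).im + η) / r := by
    intro η hη
    set m : ℝ := (F c).im + η with hm
    have hmpos : 0 < m := by have := him c (mem_ball_self hr); linarith
    -- denominator
    have hden : ∀ z ∈ ball c r, F z - F c + 2 * m * Complex.I ≠ 0 := by
      intro z hz h0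
      have := congrArg Complex.im h0
      simp at this
      have := him z hz
      linarith
    set M : ℂ → ℂ := fun z => (F z - F c) / (F z - F c + 2 * m * Complex.I) with hM
    have hMd : DifferentiableOn ℂ M (ball c r) :=
      (hF.sub_const _).div ((hF.sub_const _).add_const _) hden
    have hMc : M c = 0 := by simp [hM]
    have hmaps : MapsTo M (ball c r) (closedBall (M c) 1) := by
      intro z hz
      rw [hMc, mem_closedBall_zero_iff]
      simp only [hM, norm_div]
      apply div_le_one_of_le₀ _ (norm_nonneg _)
      rw [← sq_le_sq₀ (norm_nonneg _) (norm_nonneg _), Complex.sq_norm, Complex.sq_norm,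
        Complex.normSq_apply, Complex.normSq_apply]
      have := him z hz
      simp
      nlinarith
    have h1 := Complex.norm_deriv_le_div_of_mapsTo_ball hMd hmaps hr
    have hM' : HasDerivAt M (deriv F c / (2 * m * Complex.I)) c := by
      have := (hFc.sub_const (F c)).div ((hFc.sub_const (F c)).add_const (2 * m * Complex.I))
        (hden c (mem_ball_self hr))
      have hne : (2 * (m:ℂ) * Complex.I) ≠ 0 := by
        simp [hmpos.ne']
      have he : deriv F c / (2 * m * Complex.I) =
          (deriv F c * (F c - F c + 2 * m * Complex.I) - (F c - F c) * deriv F c) /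
            (F c - F c + 2 * m * Complex.I) ^ 2 := by
        rw [sub_self, zero_add, zero_mul, sub_zero, pow_two, mul_div_mul_right _ _ hne]
      rw [he]
      exact this
    rw [hM'.deriv, norm_div] at h1
    have h2 : ‖(2 * (m:ℂ) * Complex.I)‖ = 2 * m := by simp [abs_of_pos hmpos]
    rw [h2, div_le_iff₀ (by positivity)] at h1
    calc _ ≤ _ := h1
      _ = _ := by ring
  have : Tendsto (fun η : ℝ => 2 * ((F c).im + η) / r) (𝓝[>] 0) (𝓝 (2 * ((F c).im + 0) / r)) := by
    apply Tendsto.mono_left _ nhdsWithin_le_nhds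
    exact (by fun_prop : Continuous (fun η : ℝ => 2 * ((F c).im + η) / r)).tendsto 0
  rw [add_zero] at this
  exact ge_of_tendsto this (by filter_upwards [self_mem_nhdsWithin] with η hη using key η hη)

lemma im_max {U : Set ℂ} (hU : IsBounded U) {h : ℂ → ℂ} (hd : DiffContOnCl ℂ h U) {m : ℝ}
    (hm : ∀ z ∈ frontier U, m ≤ (h z).im) {z : ℂ} (hz : z ∈ closure U) : m ≤ (h z).im := by
  have hn : ∀ w : ℂ, ‖Complex.exp (Complex.I * w)‖ = Real.exp (-w.im) := by
    intro w; rw [Complex.norm_exp]; simp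
  have hd' : DiffContOnCl ℂ (fun z => Complex.exp (Complex.I * h z)) U :=
    ⟨(hd.differentiableOn.const_mul _).cexp, (continuousOn_const.mul hd.continuousOn).cexp⟩
  have := Complex.norm_le_of_forall_mem_frontier_norm_le hU hd' (C := Real.exp (-m))
    (by intro w hw; rw [hn]; gcongr; exact hm w hw) hz
  rw [hn, Real.exp_le_exp] at this
  linarith

lemma hydro_bound {K : Set ℂ} {f : ℂ → ℂ} (hf : IsHydroMap K f) {ε : ℝ} (hε : 0 < ε) :
    ∃ M : ℝ, ∀ z ∈ UHP, M ≤ ‖z‖ → ‖f z - z‖ < ε := by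
  have h := hf.2.2.2
  rw [Metric.tendsto_nhds] at h
  have := h ε hε
  rw [eventually_inf_principal, ← comap_norm_atTop, eventually_comap] at this
  obtain ⟨M, hM⟩ := eventually_atTop.1 this
  refine ⟨M, fun z hz hzM => ?_⟩
  simpa [dist_eq_norm] using hM _ hzM z rfl hz

lemma im_ge {K : Set ℂ} {f : ℂ → ℂ} (hf : IsHydroMap K f) {z : ℂ} (hz : z ∈ UHP) :
    z.im ≤ (f z).im := by
  apply le_of_forall_pos_le_add
  intro ε hε
  obtain ⟨M, hM⟩ := hydro_bound hf hε
  have hz0 : 0 < z.im := hz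
  set δ := min ε (z.im / 2) with hδ
  have hδ0 : 0 < δ := lt_min hε (by linarith)
  have hδε : δ ≤ ε := min_le_left _ _
  have hδz : δ < z.im := lt_of_le_of_lt (min_le_right _ _) (by linarith)
  set T := max M (‖z‖ + 1) with hT
  set U : Set ℂ := {w | δ < w.im ∧ ‖w‖ < T} with hU
  have hUo : IsOpen U := (isOpen_lt continuous_const Complex.continuous_im).inter
    (isOpen_lt continuous_norm continuous_const)
  have hcl : closure U ⊆ {w | δ ≤ w.im ∧ ‖w‖ ≤ T} := by
    apply closure_minimal
    · intro w hw; exact ⟨hw.1.le, hw.2.le⟩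
    · exact (isClosed_le continuous_const Complex.continuous_im).inter
        (isClosed_le continuous_norm continuous_const)
  have hclU : closure U ⊆ UHP := fun w hw => lt_of_lt_of_le hδ0 (hcl hw).1
  have hbd : IsBounded U := isBounded_iff_forall_norm_le.2 ⟨T, fun w hw => hw.2.le⟩
  have hdiff : DifferentiableOn ℂ (fun w => f w - w) UHP := hf.1.sub differentiableOn_id
  have hdc : DiffContOnCl ℂ (fun w => f w - w) U :=
    ⟨hdiff.mono (subset_closure.trans hclU), hdiff.continuousOn.mono hclU⟩
  have := im_max hbd hdc (m := -ε) (z := z) ?_ (subset_closure ⟨hδz, by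
    exact lt_of_lt_of_le (lt_add_one _) (le_max_right _ _)⟩)
  · simp at this; linarith
  · intro w hw
    rw [hUo.frontier_eq] at hw
    have hw1 := hclU hw.1
    have hfw : 0 < (f w).im := by
      have : f w ∈ UHP \ K := hf.2.2.1 ▸ mem_image_of_mem f hw1
      exact this.1
    by_cases h : δ < w.im
    · have hwT : T ≤ ‖w‖ := by
        by_contra! h'
        exact hw.2 ⟨h, h'⟩
      have h2 := hM w hw1 ((le_max_left _ _).trans hwT)
      have h3 := (abs_le.1 ((Complex.abs_im_le_norm (f w - w)).trans h2.le)).1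
      exact h3
    · simp; linarith

lemma inv_far {K : Set ℂ} {f g : ℂ → ℂ} (hf : IsHydroMap K f) (hg : ∀ z ∈ UHP, g (f z) = z)
    {ε : ℝ} (hε : 0 < ε) :
    ∃ ρ : ℝ, ∀ w : ℂ, ε < w.im → ρ < ‖w‖ → ‖g w - w‖ ≤ ε := by
  obtain ⟨M, hM⟩ := hydro_bound hf (show 0 < ε / 16 by positivity)
  refine ⟨M + ε, fun w hw hwρ => ?_⟩
  have hcb : ∀ z ∈ closedBall w (ε / 2), z ∈ UHP ∧ ‖f z - z‖ < ε / 16 := by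
    intro z hz
    rw [mem_closedBall, dist_eq_norm] at hz
    have h1 := (abs_le.1 ((Complex.abs_im_le_norm (z - w)).trans hz)).1
    simp only [Complex.sub_im] at h1
    have hzU : z ∈ UHP := by change 0 < z.im; linarith
    refine ⟨hzU, hM z hzU ?_⟩
    have := norm_sub_norm_le w z
    rw [norm_sub_rev] at this
    linarith
  have hr : 0 < ε / 2 := by positivity
  have hw0 := hcb w (mem_closedBall_self hr.le)
  have hdc : DiffContOnCl ℂ f (ball w (ε / 2)) := by
    refine ⟨hf.1.mono fun z hz => (hcb z (ball_subset_closedBall hz)).1, ?_⟩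
    rw [closure_ball _ hr.ne']
    exact hf.1.continuousOn.mono fun z hz => (hcb z hz).1
  have hsub := hdc.ball_subset_image_closedBall hr (ε := 3 * ε / 8) (by
    intro z hz
    have h1 := (hcb z (sphere_subset_closedBall hz)).2
    have h2 : ‖z - w‖ = ε / 2 := by rw [← dist_eq_norm]; exact hz
    have h3 : ‖z - w‖ ≤ ‖f z - f w‖ + ‖f z - z‖ + ‖f w - w‖ := by
      calc ‖z - w‖ = ‖(f z - f w) - (f z - z) + (f w - w)‖ := by congr 1; ring
        _ ≤ _ := (norm_add_le _ _).trans (by gcongr; exact norm_sub_le _ _)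
    linarith [hw0.2]) (by
    have h1 : ∀ᶠ z in 𝓝[≠] w, f z ≠ f w := by
      rw [eventually_nhdsWithin_iff]
      filter_upwards [uhp_isOpen.mem_nhds hw0.1] with z hz hzw h
      exact hzw (hf.2.1 hz hw0.1 h)
    exact h1.frequently.filter_mono nhdsWithin_le_nhds)
  obtain ⟨z, hz, hzw⟩ := hsub (show w ∈ ball (f w) (3 * ε / 8 / 2) by
    rw [mem_ball, dist_eq_norm, norm_sub_rev]; linarith [hw0.2])
  have hgz := hg z (hcb z hz).1
  rw [hzw] at hgz
  rw [hgz, ← dist_eq_norm]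
  exact (mem_closedBall.1 hz).trans (by linarith)

lemma im_div_real (R a : ℝ) (w : ℂ) :
    ((R : ℂ) ^ 2 / (w - a)).im = - (R ^ 2 * w.im / ‖w - a‖ ^ 2) := by
  rw [Complex.div_im, ← Complex.ofReal_pow, Complex.sq_norm, Complex.ofReal_im, Complex.ofReal_re]
  simp only [Complex.sub_im, Complex.ofReal_im]
  ring

lemma im_inv_lower {K : Set ℂ} {f g : ℂ → ℂ} (hf : IsHydroMap K f)
    (hgd : DifferentiableOn ℂ g (UHP \ K)) (hgm : ∀ w ∈ UHP \ K, g w ∈ UHP ∧ f (g w) = w)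
    (hg : ∀ z ∈ UHP, g (f z) = z) {a R : ℝ} (hR : 0 < R)
    (hK : ∀ p ∈ K, ‖p - a‖ ≤ R) {w : ℂ} (hw : w ∈ UHP) (hwR : R < ‖w - a‖) :
    w.im - R ^ 2 * w.im / ‖w - a‖ ^ 2 ≤ (g w).im := by
  apply le_of_forall_pos_le_add
  intro ε hε
  have hw0 : 0 < w.im := hw
  set δ := min ε (w.im / 2) with hδ
  have hδ0 : 0 < δ := lt_min hε (by linarith)
  have hδε : δ ≤ ε := min_le_left _ _
  have hδz : δ < w.im := lt_of_le_of_lt (min_le_right _ _) (by linarith)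
  obtain ⟨ρ, hρ⟩ := inv_far hf hg hδ0
  obtain ⟨R', hRR', hR'⟩ := exists_between (show R < min ‖w - a‖ (min (2 * R) (R + ε / 3)) from
    lt_min hwR (lt_min (by linarith) (by linarith)))
  have hR'w : R' < ‖w - a‖ := hR'.trans_le (min_le_left _ _)
  have hR'2 : R' < 2 * R := hR'.trans_le ((min_le_right _ _).trans (min_le_left _ _))
  have hR'3 : R' < R + ε / 3 := hR'.trans_le ((min_le_right _ _).trans (min_le_right _ _))
  set T := max (ρ + |a| + 1) (‖w - a‖ + 1) with hT
  set U : Set ℂ := {v | (δ < v.im ∧ R' < ‖v - a‖) ∧ ‖v - a‖ < T} with hU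
  have hcn : Continuous (fun v : ℂ => ‖v - a‖) := by fun_prop
  have hUo : IsOpen U := ((isOpen_lt continuous_const Complex.continuous_im).inter
    (isOpen_lt continuous_const hcn)).inter (isOpen_lt hcn continuous_const)
  have hcl : closure U ⊆ {v | (δ ≤ v.im ∧ R' ≤ ‖v - a‖) ∧ ‖v - a‖ ≤ T} := by
    apply closure_minimal
    · intro v hv; exact ⟨⟨hv.1.1.le, hv.1.2.le⟩, hv.2.le⟩
    · exact ((isClosed_le continuous_const Complex.continuous_im).inter
        (isClosed_le continuous_const hcn)).inter (isClosed_le hcn continuous_const)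
  have hclU : closure U ⊆ UHP \ K := fun v hv => by
    have h := hcl hv
    exact ⟨lt_of_lt_of_le hδ0 h.1.1, fun hvK => by linarith [hK v hvK, h.1.2]⟩
  have hbd : IsBounded U := by
    apply (isBounded_ball (x := (a : ℂ)) (r := T)).subset
    intro v hv
    rw [mem_ball, dist_eq_norm]; exact hv.2
  have hdiff : DifferentiableOn ℂ (fun v => g v - v - (R : ℂ) ^ 2 / (v - a)) (closure U) := by
    refine ((hgd.mono hclU).sub differentiableOn_id).sub
      ((differentiableOn_const _).div (differentiableOn_id.sub_const _) ?_)
    intro v hv h0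
    have := (hcl hv).1.2
    change v - (a : ℂ) = 0 at h0
    rw [h0, norm_zero] at this
    linarith
  have hdc : DiffContOnCl ℂ (fun v => g v - v - (R : ℂ) ^ 2 / (v - a)) U :=
    ⟨hdiff.mono subset_closure, hdiff.continuousOn⟩
  have := im_max hbd hdc (m := -ε) (z := w) ?_ (subset_closure ⟨⟨hδz, hR'w⟩,
    lt_of_lt_of_le (lt_add_one _) (le_max_right _ _)⟩)
  · rw [Complex.sub_im, Complex.sub_im, im_div_real] at this
    linarith
  · intro v hv
    rw [hUo.frontier_eq] at hv
    have hv1 := hclU hv.1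
    have hv2 := hcl hv.1
    have hgv : 0 < (g v).im := (hgm v hv1).1
    have hv0 : 0 < v.im := hv1.1
    rw [Complex.sub_im, Complex.sub_im, im_div_real]
    have hnp : 0 < ‖v - a‖ := by linarith [hv2.1.2]
    have hpos : 0 ≤ R ^ 2 * v.im / ‖v - a‖ ^ 2 := by positivity
    by_cases h : δ < v.im
    · by_cases h' : R' < ‖v - a‖
      · have hvT : T ≤ ‖v - a‖ := by
          by_contra! h''
          exact hv.2 ⟨⟨h, h'⟩, h''⟩
        have h2 := hρ v h (by
          have h3 : ‖v - a‖ ≤ ‖v‖ + |a| := by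
            have := norm_sub_le v (a : ℂ)
            simpa using this
          have h4 : ρ + |a| + 1 ≤ T := le_max_left _ _
          linarith)
        have h3 := (abs_le.1 ((Complex.abs_im_le_norm (g v - v)).trans h2)).1
        rw [Complex.sub_im] at h3
        linarith
      · have hvR : ‖v - a‖ = R' := le_antisymm (not_lt.1 h') hv2.1.2
        have hvi : v.im ≤ R' := by
          have := (abs_le.1 (Complex.abs_im_le_norm (v - a))).2
          simpa [hvR] using this
        rw [hvR]
        have hR'0 : 0 < R' := by linarith
        have e1 : v.im - R ^ 2 * v.im / R' ^ 2 ≤ ε := by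
          have : v.im - R ^ 2 * v.im / R' ^ 2 = v.im * ((R' - R) * (R' + R)) / R' ^ 2 := by
            field_simp
            ring
          rw [this, div_le_iff₀ (by positivity)]
          have h5 : (R' - R) * (R' + R) ≤ ε * R' := by nlinarith
          have h6 : 0 ≤ (R' - R) * (R' + R) := by apply mul_nonneg <;> linarith
          calc _ ≤ R' * (ε * R') := by gcongr
            _ = _ := by ring
        linarith
    · linarith

lemma inv_close {K : Set ℂ} {f g : ℂ → ℂ} (hf : IsHydroMap K f)
    (hgd : DifferentiableOn ℂ g (UHP \ K)) (hgm : ∀ w ∈ UHP \ K, g w ∈ UHP ∧ f (g w) = w)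
    (hg : ∀ z ∈ UHP, g (f z) = z) {a R : ℝ} (hR : 0 < R)
    (hK : ∀ p ∈ K, ‖p - a‖ ≤ R) {w : ℂ} (hw : w ∈ UHP) (hwR : R < ‖w - a‖) :
    ‖w - g w‖ ≤ 2 * R ^ 2 / (‖w - a‖ - R) := by
  have hw0 : 0 < w.im := hw
  -- the domain
  have hD : ∀ v ∈ UHP, R < ‖v - a‖ → v ∈ UHP \ K := fun v hv hvR =>
    ⟨hv, fun h => by linarith [hK v h]⟩
  have hDo : IsOpen (UHP ∩ {v : ℂ | R < ‖v - a‖}) :=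
    uhp_isOpen.inter (isOpen_lt continuous_const (by fun_prop))
  have hGd : DifferentiableOn ℂ (fun v => v - g v) (UHP ∩ {v : ℂ | R < ‖v - a‖}) :=
    differentiableOn_id.sub (hgd.mono fun v hv => hD v hv.1 hv.2)
  have hder : ∀ v ∈ UHP, R < ‖v - a‖ →
      ‖deriv (fun v => v - g v) v‖ ≤ 2 * R ^ 2 / (‖v - a‖ - R) ^ 2 := by
    intro v hv hvR
    have hv0 : 0 < v.im := hv
    set n := ‖v - a‖ with hn
    have hn0 : 0 < n := by linarith
    have hnR : 0 < n - R := by linarith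
    set r := v.im * (n - R) / n with hr
    have hr0 : 0 < r := by positivity
    have hvn : v.im ≤ n := by
      have := (abs_le.1 (Complex.abs_im_le_norm (v - a))).2
      simpa using this
    have hr1 : r ≤ v.im := by
      rw [hr, div_le_iff₀ hn0]; nlinarith
    have hr2 : r ≤ n - R := by
      rw [hr, div_le_iff₀ hn0]; nlinarith
    have hball : ball v r ⊆ UHP ∩ {v : ℂ | R < ‖v - a‖} := by
      intro u hu
      rw [mem_ball, dist_eq_norm] at hu
      constructor
      · have h1 := (abs_lt.1 ((Complex.abs_im_le_norm (u - v)).trans_lt hu)).1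
        rw [Complex.sub_im] at h1
        change 0 < u.im
        linarith
      · have : n ≤ ‖u - a‖ + ‖u - v‖ := by
          calc n = ‖(u - a) - (u - v)‖ := by rw [hn]; congr 1; ring
            _ ≤ _ := norm_sub_le _ _
        change R < ‖u - a‖
        linarith
    have h1 := schwarz_im hr0 (hGd.mono hball) (by
      intro u hu
      have hu' := hball hu
      have h2 := hgm u (hD u hu'.1 hu'.2)
      have h3 := im_ge hf h2.1
      rw [h2.2] at h3
      simp only [Complex.sub_im]
      linarith)
    refine h1.trans ?_
    have h4 := im_inv_lower hf hgd hgm hg hR hK hv hvR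
    have h5 : (v - g v).im ≤ R ^ 2 * v.im / n ^ 2 := by
      rw [Complex.sub_im]; linarith
    calc 2 * (v - g v).im / r ≤ 2 * (R ^ 2 * v.im / n ^ 2) / r := by gcongr
      _ = 2 * R ^ 2 / (n * (n - R)) := by rw [hr]; field_simp
      _ ≤ 2 * R ^ 2 / ((n - R) ^ 2) := by
        rw [pow_two (n - R)]
        gcongr
        linarith
  -- radial path
  set s := ‖w - a‖ with hs
  have hs0 : 0 < s := by linarith
  set e : ℂ := (w - a) / s with he
  have hsC : (s : ℂ) ≠ 0 := by exact_mod_cast hs0.ne'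
  have hen : ‖e‖ = 1 := by
    rw [he, norm_div, ← hs, Complex.norm_real, Real.norm_of_nonneg hs0.le, div_self hs0.ne']
  have hei : 0 < e.im := by
    rw [he, Complex.div_ofReal_im]; simp; positivity
  set γ : ℝ → ℂ := fun t => a + t * e with hγ
  have hγi : ∀ t, (γ t).im = t * e.im := by intro t; simp [hγ]
  have hγn : ∀ t, 0 ≤ t → ‖γ t - a‖ = t := by
    intro t ht; simp [hγ, hen, abs_of_nonneg ht]
  have hγs : γ s = w := by simp only [hγ, he]; field_simp; ring
  have hγU : ∀ t, 0 < t → γ t ∈ UHP := fun t ht => by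
    change 0 < (γ t).im; rw [hγi]; positivity
  have hγd : ∀ t, HasDerivAt γ e t := by
    intro t
    simpa [hγ] using ((Complex.ofRealCLM.hasDerivAt (x := t)).mul_const e).const_add (a : ℂ)
  set G : ℂ → ℂ := fun v => v - g v with hG
  have hGγ : ∀ t, R < t → HasDerivAt (fun t => G (γ t)) (deriv G (γ t) * e) t := by
    intro t ht
    have ht0 : 0 < t := by linarith
    have h1 : HasDerivAt G (deriv G (γ t)) (γ t) :=
      (hGd.differentiableAt (hDo.mem_nhds ⟨hγU t ht0, by
        change R < ‖γ t - a‖; rw [hγn t ht0.le]; exact ht⟩)).hasDerivAt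
    exact h1.comp t (hγd t)
  have hbound : ∀ t, s ≤ t → ‖G (γ t) - G (γ s)‖ ≤ 2 * R ^ 2 / (s - R) - 2 * R ^ 2 / (t - R) := by
    intro t ht
    refine image_norm_le_of_norm_deriv_right_le_deriv_boundary' (a := s) (b := t)
      (f := fun t => G (γ t) - G (γ s)) (f' := fun t => deriv G (γ t) * e)
      (B := fun t => 2 * R ^ 2 / (s - R) - 2 * R ^ 2 / (t - R))
      (B' := fun t => 2 * R ^ 2 / (t - R) ^ 2) ?_ ?_ ?_ ?_ ?_ ?_ ⟨ht, le_rfl⟩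
    · intro x hx
      exact ((hGγ x (by linarith [hx.1])).continuousAt.sub continuousAt_const).continuousWithinAt
    · intro x hx
      exact ((hGγ x (by linarith [hx.1])).sub_const _).hasDerivWithinAt
    · simp
    · intro x hx
      have : x - R ≠ 0 := by have := hx.1; intro h; linarith
      apply ContinuousAt.continuousWithinAt
      fun_prop (disch := assumption)
    · intro x hx
      have hne : x - R ≠ 0 := by have := hx.1; intro h; linarith
      apply HasDerivAt.hasDerivWithinAt
      have h1 := (((hasDerivAt_id x).sub_const R).inv hne).const_mul (2 * R ^ 2)
      have h2 := h1.const_sub (2 * R ^ 2 / (s - R))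
      have e2 : 2 * R ^ 2 / (x - R) ^ 2 = -(2 * R ^ 2 * (-1 / (id x - R) ^ 2)) := by
        simp only [id]; ring
      rw [e2]
      simp only [div_eq_mul_inv] at h2 ⊢
      exact h2
    · intro x hx
      have hx0 : 0 < x := by linarith [hx.1]
      rw [norm_mul, hen, mul_one]
      have := hder (γ x) (hγU x hx0) (by rw [hγn x hx0.le]; linarith [hx.1])
      rwa [hγn x hx0.le] at this
  apply le_of_forall_pos_le_add
  intro ε hε
  obtain ⟨ρ, hρ⟩ := inv_far hf hg hε
  set t := max s (max (ρ + |a| + 1) ((ε + 1) / e.im)) with ht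
  have ht1 : s ≤ t := le_max_left _ _
  have ht2 : ρ + |a| + 1 ≤ t := (le_max_left _ _).trans (le_max_right _ _)
  have ht3 : (ε + 1) / e.im ≤ t := (le_max_right _ _).trans (le_max_right _ _)
  have h1 := hbound t ht1
  have h2 := hρ (γ t) (by
    rw [hγi]; rw [div_le_iff₀ hei] at ht3; linarith) (by
    have h3 := norm_sub_le (γ t) (a : ℂ)
    rw [hγn t (by linarith)] at h3
    simp only [Complex.norm_real, Real.norm_eq_abs] at h3
    linarith)
  have h4 : 0 ≤ 2 * R ^ 2 / (t - R) := by
    have : 0 < t - R := by linarith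
    positivity
  rw [hγs] at h1
  have h5 : ‖G w‖ ≤ ‖G (γ t) - G w‖ + ‖g (γ t) - γ t‖ := by
    calc ‖G w‖ = ‖-(G (γ t) - G w) - (g (γ t) - γ t)‖ := by
          congr 1; simp only [hG]; ring
      _ ≤ _ := (norm_sub_le _ _).trans (by rw [norm_neg])
  change ‖G w‖ ≤ _
  linarith

lemma far_main {K : Set ℂ} {f : ℂ → ℂ} (ho : IsOpen (UHP \ K)) (hf : IsHydroMap K f)
    {a d : ℝ} (hd : 0 < d) (hK : ∀ p ∈ K, ‖p - a‖ ≤ 3 / 2 * d) {z : ℂ} (hz : z ∈ UHP)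
    (hzd : 6 * d ≤ ‖z - a‖) : ‖deriv f z - 1‖ ≤ 1 / 2 ∧ ‖f z - z‖ ≤ 12 / 5 * d := by
  obtain ⟨g, hgd, hgm, hg⟩ := inv_exists ho hf
  have hR : 0 < 3 / 2 * d := by positivity
  have hz0 : 0 < z.im := hz
  have hfm : ∀ v ∈ UHP, f v ∈ UHP \ K := fun v hv => hf.2.2.1 ▸ mem_image_of_mem f hv
  have hclose : ∀ v ∈ UHP, 17 / 5 * d ≤ ‖f v - a‖ → ‖f v - v‖ ≤ 12 / 5 * d := by
    intro v hv hvd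
    have h1 := inv_close hf hgd hgm hg hR hK (hfm v hv).1 (by linarith)
    rw [hg v hv] at h1
    refine h1.trans ?_
    rw [div_le_iff₀ (by linarith)]
    nlinarith
  have hfar : 17 / 5 * d ≤ ‖f z - a‖ := by
    by_contra! hlt
    obtain ⟨M, hM⟩ := hydro_bound hf one_pos
    set n := ‖z - a‖ with hn
    have hn0 : 0 < n := by linarith
    set γ : ℝ → ℂ := fun t => a + t * (z - a) with hγ
    have hγi : ∀ t, (γ t).im = t * z.im := by intro t; simp [hγ]
    have hγn : ∀ t, 0 ≤ t → ‖γ t - a‖ = t * n := by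
      intro t ht; simp [hγ, abs_of_nonneg ht, hn]
    have hγU : ∀ t, 0 < t → γ t ∈ UHP := fun t ht => by
      change 0 < (γ t).im; rw [hγi]; positivity
    have hγ1 : γ 1 = z := by simp [hγ]
    have hγc : Continuous γ := by fun_prop
    set T := max 1 (max ((M + |a|) / n) ((17 / 5 * d + 1) / n)) with hT
    have hT1 : 1 ≤ T := le_max_left _ _
    have hT2 : (M + |a|) ≤ T * n := (div_le_iff₀ hn0).1 ((le_max_left _ _).trans (le_max_right _ _))
    have hT3 : (17 / 5 * d + 1) ≤ T * n :=
      (div_le_iff₀ hn0).1 ((le_max_right _ _).trans (le_max_right _ _))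
    have hTU := hγU T (by linarith)
    have h1 := hγn T (by linarith)
    have h2 := hM (γ T) hTU (by
      have h3 := norm_sub_le (γ T) (a : ℂ)
      simp only [Complex.norm_real, Real.norm_eq_abs] at h3
      linarith)
    have h3 : ‖γ T - a‖ ≤ ‖f (γ T) - a‖ + ‖f (γ T) - γ T‖ := by
      calc ‖γ T - a‖ = ‖(f (γ T) - a) - (f (γ T) - γ T)‖ := by congr 1; ring
        _ ≤ _ := norm_sub_le _ _
    have hc : ContinuousOn (fun t => ‖f (γ t) - a‖) (Icc 1 T) := by
      have : ContinuousOn (fun t => f (γ t)) (Icc 1 T) :=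
        hf.1.continuousOn.comp hγc.continuousOn (fun t ht => hγU t (by linarith [ht.1]))
      exact (this.sub continuousOn_const).norm
    obtain ⟨t, ht, hte⟩ := intermediate_value_Icc hT1 hc
      (show 17 / 5 * d ∈ Icc _ _ from ⟨by simp only [hγ1]; exact hlt.le, by linarith⟩)
    simp only at hte
    have h4 := hclose (γ t) (hγU t (by linarith [ht.1])) hte.ge
    have h5 : ‖γ t - a‖ ≤ ‖f (γ t) - a‖ + ‖f (γ t) - γ t‖ := by
      calc ‖γ t - a‖ = ‖(f (γ t) - a) - (f (γ t) - γ t)‖ := by congr 1; ring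
        _ ≤ _ := norm_sub_le _ _
    rw [hγn t (by linarith [ht.1]), hte] at h5
    nlinarith [ht.1]
  refine ⟨?_, hclose z hz hfar⟩
  have h1 := im_inv_lower hf hgd hgm hg hR hK (hfm z hz).1 (by linarith)
  rw [hg z hz] at h1
  have hw0 : 0 < (f z).im := (hfm z hz).1
  have hn0 : 0 < ‖f z - a‖ := by linarith
  have h2 : (3 / 2 * d) ^ 2 * (f z).im / ‖f z - a‖ ^ 2 ≤ 1 / 5 * (f z).im := by
    rw [div_le_iff₀ (by positivity)]
    have : (17 / 5 * d) ^ 2 ≤ ‖f z - a‖ ^ 2 := by gcongr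
    have h3 : (3 / 2 * d) ^ 2 ≤ 1 / 5 * ‖f z - a‖ ^ 2 := by nlinarith
    nlinarith
  have hball : ball z z.im ⊆ UHP := by
    intro u hu
    rw [mem_ball, dist_eq_norm] at hu
    have h1 := (abs_lt.1 ((Complex.abs_im_le_norm (u - z)).trans_lt hu)).1
    rw [Complex.sub_im] at h1
    change 0 < u.im
    linarith
  have h4 := schwarz_im hz0 ((hf.1.sub differentiableOn_id).mono hball) (by
    intro u hu
    have := im_ge hf (hball hu)
    simp
    linarith)
  have hfd : DifferentiableAt ℂ f z := hf.1.differentiableAt (uhp_isOpen.mem_nhds hz)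
  rw [deriv_sub hfd differentiableAt_id, deriv_id] at h4
  refine h4.trans ?_
  rw [div_le_iff₀ hz0]
  simp
  linarith

lemma seg_norm (z z' : ℂ) (t : ℝ) :
    ‖(1 - t) • z + t • z'‖ ^ 2 = (1 - t) * ‖z‖ ^ 2 + t * ‖z'‖ ^ 2 - t * (1 - t) * ‖z - z'‖ ^ 2 := by
  simp only [Complex.sq_norm, Complex.normSq_apply]
  simp
  ring

/-- **estimate `fardist`.** Far from the hull, `|f'(z) - 1| ≤ 1/2`; in
particular `f` is bi-Lipschitz with uniform constants on that region. -/
theorem hydro_deriv_far_from_hull :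
    ∃ c Cb : ℝ, 0 < c ∧ 0 < Cb ∧
      ∀ (K : Set ℂ) (f : ℂ → ℂ), IsHull K → K.Nonempty → IsHydroMap K f →
        (∀ z ∈ UHP, 7 * Metric.diam K ≤ infDist z K → ‖deriv f z - 1‖ ≤ 1/2) ∧
        (∀ z ∈ UHP, 7 * Metric.diam K ≤ infDist z K →
          ∀ z' ∈ UHP, 7 * Metric.diam K ≤ infDist z' K →
            c * dist z z' ≤ dist (f z) (f z') ∧
              dist (f z) (f z') ≤ Cb * dist z z') := by
  refine ⟨1 / 5, 2, by norm_num, by norm_num, ?_⟩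
  rintro K f hK ⟨p, hp⟩ hf
  set d := Metric.diam K with hd
  have hpd : p.im ≤ d := hull_im_le hK hp
  have hp0 : 0 < p.im := hK.2.1 hp
  have hd0 : 0 < d := by linarith
  have hKa : ∀ q ∈ K, ‖q - (p.re : ℝ)‖ ≤ 3 / 2 * d := by
    intro q hq
    have h1 : q.im ≤ d := hull_im_le hK hq
    have h2 : 0 < q.im := hK.2.1 hq
    have h3 : ‖q - p‖ ≤ d := by
      rw [← dist_eq_norm]; exact Metric.dist_le_diam_of_mem hK.1 hq hp
    have h4 : |(q - p).re| ≤ d := (Complex.abs_re_le_norm _).trans h3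
    rw [Complex.sub_re] at h4
    have h5 : (q.re - p.re) ^ 2 ≤ d ^ 2 := sq_le_sq' (abs_le.1 h4).1 (abs_le.1 h4).2
    rw [← sq_le_sq₀ (norm_nonneg _) (by positivity), Complex.sq_norm, Complex.normSq_apply]
    simp
    nlinarith
  have hfar : ∀ z ∈ UHP, 7 * d ≤ infDist z K → 48 * d ^ 2 ≤ ‖z - (p.re : ℝ)‖ ^ 2 := by
    intro z hz hzd
    have hz0 : 0 < z.im := hz
    have h1 : 7 * d ≤ ‖z - p‖ := by
      rw [← dist_eq_norm]; exact hzd.trans (infDist_le_dist_of_mem hp)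
    have h2 : (7 * d) ^ 2 ≤ ‖z - p‖ ^ 2 := by gcongr
    rw [Complex.sq_norm, Complex.normSq_apply] at h2 ⊢
    simp at h2 ⊢
    nlinarith [mul_pos hz0 hp0]
  have hlt : ∀ z : ℂ, 36 * d ^ 2 ≤ ‖z - (p.re : ℝ)‖ ^ 2 → 6 * d ≤ ‖z - (p.re : ℝ)‖ := by
    intro z hz
    rw [← sq_le_sq₀ (by positivity) (norm_nonneg _)]
    linarith
  have hmain := fun (z : ℂ) (hz : z ∈ UHP) (h : 36 * d ^ 2 ≤ ‖z - (p.re : ℝ)‖ ^ 2) =>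
    far_main hK.2.2.1 hf hd0 hKa hz (hlt z h)
  have hd2 : 0 < d ^ 2 := by positivity
  refine ⟨fun z hz h => (hmain z hz (by linarith [hfar z hz h])).1, ?_⟩
  intro z hz h z' hz' h'
  have hz2 := hfar z hz h
  have hz2' := hfar z' hz' h'
  have key : ‖(f z' - z') - (f z - z)‖ ≤ 4 / 5 * ‖z' - z‖ := by
    rcases le_total ‖z' - z‖ (6 * d) with hs | hs
    · have hseg : ∀ v ∈ segment ℝ z z', v ∈ UHP ∧ 36 * d ^ 2 ≤ ‖v - (p.re : ℝ)‖ ^ 2 := by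
        intro v hv
        refine ⟨(convex_halfSpace_im_gt 0).segment_subset hz hz' hv, ?_⟩
        rw [segment_eq_image] at hv
        obtain ⟨t, ht, rfl⟩ := hv
        have e1 : (1 - t) • z + t • z' - ((p.re : ℝ) : ℂ) =
            (1 - t) • (z - ((p.re : ℝ) : ℂ)) + t • (z' - ((p.re : ℝ) : ℂ)) := by
          simp only [Complex.real_smul]; push_cast; ring
        simp only [e1, seg_norm]
        have e2 : z - ((p.re : ℝ) : ℂ) - (z' - ((p.re : ℝ) : ℂ)) = -(z' - z) := by ring
        rw [e2, norm_neg]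
        have h1 : ‖z' - z‖ ^ 2 ≤ (6 * d) ^ 2 := by gcongr
        have h2 : t * (1 - t) ≤ 1 / 4 := by nlinarith [sq_nonneg (t - 1 / 2)]
        have h3 : t * (1 - t) * ‖z' - z‖ ^ 2 ≤ 1 / 4 * (6 * d) ^ 2 := by gcongr
        have h4 : (1 - t) * (48 * d ^ 2) ≤ (1 - t) * ‖z - ((p.re : ℝ) : ℂ)‖ ^ 2 :=
          mul_le_mul_of_nonneg_left hz2 (by linarith [ht.2])
        have h5 : t * (48 * d ^ 2) ≤ t * ‖z' - ((p.re : ℝ) : ℂ)‖ ^ 2 :=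
          mul_le_mul_of_nonneg_left hz2' ht.1
        nlinarith
      have := (convex_segment z z').norm_image_sub_le_of_norm_hasDerivWithin_le
        (f := fun v => f v - v) (f' := fun v => deriv f v - 1) (C := 1 / 2) (x := z) (y := z')
        (fun v hv => ((hf.1.differentiableAt (uhp_isOpen.mem_nhds (hseg v hv).1)).hasDerivAt.sub
          (hasDerivAt_id v)).hasDerivWithinAt)
        (fun v hv => (hmain v (hseg v hv).1 (hseg v hv).2).1)
        (left_mem_segment _ _ _) (right_mem_segment _ _ _)
      linarith [norm_nonneg (z' - z)]
    · have h1 := (hmain z hz (by linarith)).2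
      have h2 := (hmain z' hz' (by linarith)).2
      calc _ ≤ ‖f z' - z'‖ + ‖f z - z‖ := norm_sub_le _ _
        _ ≤ _ := by linarith
  rw [dist_comm z z', dist_comm (f z), dist_eq_norm, dist_eq_norm]
  have h1 : ‖f z' - f z‖ ≤ ‖(f z' - z') - (f z - z)‖ + ‖z' - z‖ := by
    calc _ = ‖((f z' - z') - (f z - z)) + (z' - z)‖ := by congr 1; ring
      _ ≤ _ := norm_add_le _ _
  have h2 : ‖z' - z‖ ≤ ‖f z' - f z‖ + ‖(f z' - z') - (f z - z)‖ := by
    calc _ = ‖(f z' - f z) - ((f z' - z') - (f z - z))‖ := by congr 1; ring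
      _ ≤ _ := norm_sub_le _ _
  have h3 := norm_nonneg (z' - z)
  constructor <;> linarith
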